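/- (Proposition 2: one driver population with elastic demand and a single controller.) Let d₁, d₂, d₃ be natural numbers with d = d₁ + d₂ + d₃, and let 𝒜 be a d×d real matrix that is block lower triangular with respect to this decomposition, with diagonal blocks Â¹ = diag(A_1¹, …, A_{N₁}¹), Â² = diag(A_1², …, A_{N₂}²), and A_c, where every matrix A_i¹, A_i², A_c is Schur. Let β₁, …, β_L ∈ ℝ^d and define W_ℓ(ξ) = 𝒜ξ + β_ℓ. Let p₁, …, p_L : ℝ^d → [0,1] be Dini continuous probability functions with Σ_ℓ p_ℓ(x) = 1 and p_ℓ(x) ≥ δ for some δ > 0 and all x. Then the Markov kernel κ(x) = Σ_ℓ p_ℓ(x)·δ_{W_ℓ(x)} admits a unique invariant Borel probability measure, and this measure is attractive. -/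

import Mathlib

open MeasureTheory Filter Topology

noncomputable section

/-- A real square matrix is Schur if every complex eigenvalue has modulus `< 1`. -/
def IsSchur {ι : Type*} [Fintype ι] [DecidableEq ι] (A : Matrix ι ι ℝ) : Prop :=
  ∀ z ∈ spectrum ℂ (A.map (fun x : ℝ => (x : ℂ))), ‖z‖ < 1

/-- `p` is Dini continuous: `|p x - p y| ≤ φ (dist x y)` for a nondecreasing modulus `φ` with
`φ 0 = 0` and `∫₀¹ φ t / t dt < ∞`. -/
def DiniContinuous {X : Type*} [PseudoMetricSpace X] (p : X → ℝ) : Prop :=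
  ∃ φ : ℝ → ℝ, MonotoneOn φ (Set.Ici 0) ∧ φ 0 = 0 ∧
    IntervalIntegrable (fun t => φ t / t) volume 0 1 ∧
    ∀ x y, |p x - p y| ≤ φ (dist x y)

/-- The Markov kernel `κ x = ∑ ℓ, p ℓ x • δ_{W ℓ x}` of an iterated random function given by
maps `W ℓ` chosen with place-dependent probabilities `p ℓ`. -/
def IFSKernel {X : Type*} [MeasurableSpace X] {L : ℕ}
    (p : Fin L → X → ℝ) (W : Fin L → X → X) (x : X) : Measure X :=
  ∑ ℓ, ENNReal.ofReal (p ℓ x) • Measure.dirac (W ℓ x)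

/-- A measure `μ` is invariant for the kernel `κ` if `μ.bind κ = μ`. -/
def Invariant {X : Type*} [MeasurableSpace X] (κ : X → Measure X) (μ : Measure X) : Prop :=
  μ.bind κ = μ

/-- A measure `μ` is attractive for the kernel `κ` if for every Borel probability measure `ν`,
the iterates `ν, ν.bind κ, (ν.bind κ).bind κ, …` converge weakly to `μ`. -/
def Attractive {X : Type*} [MeasurableSpace X] [TopologicalSpace X]
    (κ : X → Measure X) (μ : Measure X) : Prop :=
  ∀ ν : Measure X, IsProbabilityMeasure ν →
    ∀ f : BoundedContinuousFunction X ℝ,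
      Tendsto (fun k => ∫ x, f x ∂((fun m : Measure X => m.bind κ)^[k] ν))
        atTop (𝓝 (∫ x, f x ∂μ))

/-- The index set of the augmented state in Proposition 2: the states of the driver
population, the states of the elastic-demand population, and the state of the controller. -/
abbrev Idx3 (N₁ N₂ : ℕ) (n₁ : Fin N₁ → ℕ) (n₂ : Fin N₂ → ℕ) (d₃ : ℕ) : Type :=
  ((i : Fin N₁) × Fin (n₁ i)) ⊕ (((i : Fin N₂) × Fin (n₂ i)) ⊕ Fin d₃)

/-- The block an index belongs to, for the three-block decomposition of Proposition 2. -/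
def blk3 {N₁ N₂ : ℕ} {n₁ : Fin N₁ → ℕ} {n₂ : Fin N₂ → ℕ} {d₃ : ℕ} :
    Idx3 N₁ N₂ n₁ n₂ d₃ → ℕ :=
  Sum.elim (fun _ => 0) (Sum.elim (fun _ => 1) (fun _ => 2))

def UOp {X : Type*} {L : ℕ} (p : Fin L → X → ℝ) (W : Fin L → X → X) (f : X → ℝ) (x : X) : ℝ :=
  ∑ ℓ, p ℓ x * f (W ℓ x)

lemma one_step {L : ℕ} (a b u v : Fin L → ℝ) (ha : ∑ i, a i = 1)
    (hb : ∑ i, b i = 1) (e D τ : ℝ) (he : ∀ i, u i - v i ≤ e) (hD : ∀ i j, u i - v j ≤ D)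
    (heD : e ≤ D) (ha0 : ∀ i, 0 ≤ a i) (hb0 : ∀ i, 0 ≤ b i)
    (hτ : 1 - τ ≤ ∑ i, min (a i) (b i)) :
    ∑ i, a i * u i - ∑ i, b i * v i ≤ (1 - τ) * e + τ * D := by
  have hne : (Finset.univ : Finset (Fin L)).Nonempty := by
    by_contra h
    rw [Finset.not_nonempty_iff_eq_empty] at h
    rw [h] at ha
    simp at ha
  obtain ⟨j, -, hj⟩ := Finset.exists_min_image Finset.univ v hne
  set s := ∑ i, min (a i) (b i) with hs
  have h1 : ∑ i, min (a i) (b i) * (u i - v i) ≤ s * e := by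
    rw [hs, Finset.sum_mul]
    exact Finset.sum_le_sum fun i _ => mul_le_mul_of_nonneg_left (he i) (le_min (ha0 i) (hb0 i))
  have h2 : ∑ i, (a i - min (a i) (b i)) * u i ≤ (1 - s) * (v j + D) := by
    rw [hs, ← ha, ← Finset.sum_sub_distrib, Finset.sum_mul]
    refine Finset.sum_le_sum fun i _ => mul_le_mul_of_nonneg_left ?_ ?_
    · linarith [hD i j]
    · linarith [min_le_left (a i) (b i)]
  have h3 : (1 - s) * v j ≤ ∑ i, (b i - min (a i) (b i)) * v i := by
    rw [hs, ← hb, ← Finset.sum_sub_distrib, Finset.sum_mul]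
    refine Finset.sum_le_sum fun i _ => mul_le_mul_of_nonneg_left (hj i (Finset.mem_univ i)) ?_
    linarith [min_le_right (a i) (b i)]
  have h4 : ∑ i, a i * u i - ∑ i, b i * v i = ∑ i, min (a i) (b i) * (u i - v i)
      + ∑ i, (a i - min (a i) (b i)) * u i - ∑ i, (b i - min (a i) (b i)) * v i := by
    rw [← Finset.sum_add_distrib, ← Finset.sum_sub_distrib, ← Finset.sum_sub_distrib]
    exact Finset.sum_congr rfl fun i _ => by ring
  rw [h4]
  nlinarith

lemma osc_tendsto {X : Type*} {L : ℕ} (p : Fin L → X → ℝ) (W : Fin L → X → X)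
    (K : Set X) (R : ℕ → X → X → Prop)
    (hK : ∀ ℓ, ∀ x ∈ K, W ℓ x ∈ K)
    (hR0 : ∀ x ∈ K, ∀ y ∈ K, R 0 x y) (hRs : ∀ j ℓ x y, R j x y → R (j+1) (W ℓ x) (W ℓ y))
    (hRr : ∀ j x, R j x x)
    (hp0 : ∀ ℓ x, 0 ≤ p ℓ x) (hp1 : ∀ x, ∑ ℓ, p ℓ x = 1)
    (τ : ℕ → ℝ) (hτ0 : ∀ j, 0 ≤ τ j) (hτ1 : ∀ j, τ j < 1) (hτs : Summable τ)
    (hτ : ∀ j, ∀ x ∈ K, ∀ y ∈ K, R j x y → 1 - τ j ≤ ∑ ℓ, min (p ℓ x) (p ℓ y))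
    (f : X → ℝ) (B : ℝ) (hB : ∀ x, |f x| ≤ B)
    (hf : ∀ ε > 0, ∀ᶠ j in atTop, ∀ x ∈ K, ∀ y ∈ K, R j x y → f x - f y ≤ ε) :
    ∀ ε > 0, ∀ᶠ n in atTop, ∀ x ∈ K, ∀ y ∈ K,
      (UOp p W)^[n] f x - (UOp p W)^[n] f y ≤ ε := by
  rcases K.eq_empty_or_nonempty with rfl | ⟨x0, hx0⟩
  · intro ε _; simp
  set g : ℕ → X → ℝ := fun n => (UOp p W)^[n] f with hg
  have hgs : ∀ n x, g (n+1) x = ∑ ℓ, p ℓ x * g n (W ℓ x) := by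
    intro n x; simp only [hg, Function.iterate_succ_apply']; rfl
  have hgB : ∀ n x, |g n x| ≤ B := by
    intro n
    induction n with
    | zero => exact hB
    | succ n ih =>
      intro x
      rw [hgs]
      calc |∑ ℓ, p ℓ x * g n (W ℓ x)| ≤ ∑ ℓ, |p ℓ x * g n (W ℓ x)| := Finset.abs_sum_le_sum_abs _ _
        _ ≤ ∑ ℓ, p ℓ x * B := Finset.sum_le_sum fun ℓ _ => by
            rw [abs_mul, abs_of_nonneg (hp0 ℓ x)]
            exact mul_le_mul_of_nonneg_left (ih _) (hp0 ℓ x)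
        _ = B := by rw [← Finset.sum_mul, hp1, one_mul]
  set S : ℕ → ℕ → Set ℝ := fun n j => {r | ∃ x ∈ K, ∃ y ∈ K, R j x y ∧ r = g n x - g n y} with hS
  set E : ℕ → ℕ → ℝ := fun n j => sSup (S n j) with hE
  have hbdd : ∀ n j, BddAbove (S n j) := by
    intro n j
    refine ⟨2 * B, ?_⟩
    rintro r ⟨x, _, y, _, _, rfl⟩
    have h1 := abs_le.1 (hgB n x); have h2 := abs_le.1 (hgB n y)
    linarith [h1.1, h1.2, h2.1, h2.2]
  have hle : ∀ n j, ∀ x ∈ K, ∀ y ∈ K, R j x y → g n x - g n y ≤ E n j :=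
    fun n j x hx y hy h => le_csSup (hbdd n j) ⟨x, hx, y, hy, h, rfl⟩
  have hne : ∀ n j, (S n j).Nonempty := fun n j => ⟨_, x0, hx0, x0, hx0, hRr j x0, rfl⟩
  have hE0 : ∀ n j, 0 ≤ E n j := fun n j => by
    simpa using hle n j x0 hx0 x0 hx0 (hRr j x0)
  have hEle : ∀ n j c, (∀ x ∈ K, ∀ y ∈ K, R j x y → g n x - g n y ≤ c) → E n j ≤ c := by
    intro n j c h
    refine csSup_le (hne n j) ?_
    rintro r ⟨x, hx, y, hy, hxy, rfl⟩
    exact h x hx y hy hxy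
  have hED : ∀ n j, E n j ≤ E n 0 := fun n j =>
    hEle n j _ fun x hx y hy _ => hle n 0 x hx y hy (hR0 x hx y hy)
  have hstep : ∀ n j, E (n+1) j ≤ (1 - τ j) * E n (j+1) + τ j * E n 0 := by
    intro n j
    refine hEle _ _ _ fun x hx y hy hxy => ?_
    rw [hgs, hgs]
    exact one_step _ _ _ _ (hp1 x) (hp1 y) _ _ _
      (fun i => hle n (j+1) _ (hK i x hx) _ (hK i y hy) (hRs j i x y hxy))
      (fun i i' => hle n 0 _ (hK i x hx) _ (hK i' y hy) (hR0 _ (hK i x hx) _ (hK i' y hy)))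
      (hED n (j+1)) (fun i => hp0 i x) (fun i => hp0 i y) (hτ j x hx y hy hxy)
  have hanti : Antitone fun n => E n 0 := by
    refine antitone_nat_of_succ_le fun n => ?_
    have := hstep n 0
    nlinarith [hED n 1, hτ0 0, hτ1 0]
  have hbb : BddBelow (Set.range fun n => E n 0) := ⟨0, by rintro _ ⟨n, rfl⟩; exact hE0 n 0⟩
  have hlim := tendsto_atTop_ciInf hanti hbb
  set D := ⨅ n, E n 0 with hD
  have hlow : ∀ m, ∀ ε > 0, ∀ᶠ n in atTop, D - ε ≤ E n m := by
    intro m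
    induction m with
    | zero =>
      intro ε hε
      exact Eventually.of_forall fun n => by linarith [ciInf_le hbb n]
    | succ m ih =>
      intro ε hε
      have ht : 0 < 1 - τ m := by linarith [hτ1 m]
      have hη : 0 < ε * (1 - τ m) / 2 := by positivity
      have h1 := (tendsto_add_atTop_nat 1).eventually (ih _ hη)
      have h2 : ∀ᶠ n in atTop, E n 0 < D + ε * (1 - τ m) / 2 :=
        hlim.eventually_lt_const (by linarith)
      filter_upwards [h1, h2] with n h1 h2
      have h3 := hstep n m
      have h4 : (1 - τ m) * (D - ε) ≤ (1 - τ m) * E n (m+1) := by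
        nlinarith [hτ0 m, hτ1 m]
      exact le_of_mul_le_mul_left h4 ht
  have hup : ∀ n m, E n m ≤ E 0 (m+n) + E 0 0 * ∑ i ∈ Finset.range n, τ (i + m) := by
    intro n
    induction n with
    | zero => intro m; simp
    | succ n ih =>
      intro m
      have h1 := hstep n m
      have h2 := ih (m+1)
      have h3 := hanti (Nat.zero_le n)
      simp only at h3
      rw [Finset.sum_range_succ']
      have h4 : ∀ i, i + 1 + m = i + (m + 1) := fun i => by omega
      simp only [h4, zero_add]
      have h5 : m + (n + 1) = m + 1 + n := by omega
      rw [h5]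
      nlinarith [hτ0 m, hτ1 m, hE0 n (m+1)]
  have hEz : Tendsto (fun j => E 0 j) atTop (𝓝 0) := by
    rw [Metric.tendsto_nhds]
    intro ε hε
    filter_upwards [hf (ε/2) (by positivity)] with j hj
    rw [Real.dist_eq, sub_zero, abs_of_nonneg (hE0 0 j)]
    have := hEle 0 j (ε/2) hj
    linarith
  have hDm : ∀ m, D ≤ E 0 0 * ∑' i, τ (i + m) := by
    intro m
    have hb : ∀ n, E n m ≤ E 0 (m+n) + E 0 0 * ∑' i, τ (i + m) := by
      intro n
      refine (hup n m).trans ?_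
      gcongr
      · exact hE0 0 0
      · exact ((summable_nat_add_iff m).2 hτs).sum_le_tsum _ (fun i _ => hτ0 _)
    refine le_of_forall_pos_le_add fun ε hε => ?_
    have h1 := hlow m (ε/2) (by positivity)
    have h2 : Tendsto (fun n => E 0 (m+n)) atTop (𝓝 0) := by
      have := (tendsto_add_atTop_iff_nat (f := fun j => E 0 j) m).2 hEz
      simpa [add_comm] using this
    have h3 : ∀ᶠ n in atTop, E 0 (m+n) < ε/2 := h2.eventually_lt_const (by positivity)
    obtain ⟨n, h1, h3⟩ := (h1.and h3).exists
    linarith [hb n]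
  have hD0 : D ≤ 0 := by
    have h := (tendsto_sum_nat_add τ).const_mul (E 0 0)
    rw [mul_zero] at h
    exact ge_of_tendsto' h hDm
  intro ε hε
  have : ∀ᶠ n in atTop, E n 0 < ε := hlim.eventually_lt_const (by linarith)
  filter_upwards [this] with n hn x hx y hy
  exact (hle n 0 x hx y hy (hR0 x hx y hy)).trans hn.le

lemma dini_summable {φ : ℝ → ℝ} (hm : MonotoneOn φ (Set.Ici 0)) (h0 : φ 0 = 0)
    (hi : IntervalIntegrable (fun t => φ t / t) volume 0 1) {ρ : ℝ} (hρ0 : 0 < ρ) (hρ1 : ρ < 1)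
    {r : ℝ} (hr : 0 ≤ r) : Summable fun k : ℕ => φ (r * ρ ^ k) := by
  have hnn : ∀ t, 0 ≤ t → 0 ≤ φ t := fun t ht => by
    rw [← h0]; exact hm (Set.mem_Ici.2 le_rfl) ht ht
  have hsub : ∀ a b, 0 ≤ a → a ≤ b → b ≤ 1 → IntervalIntegrable (fun t => φ t / t) volume a b := by
    intro a b ha hab hb
    refine hi.mono_set ?_
    rw [Set.uIcc_of_le hab, Set.uIcc_of_le zero_le_one]
    exact Set.Icc_subset_Icc ha hb
  have hpow : ∀ k : ℕ, ρ ^ k ≤ 1 := fun k => pow_le_one₀ hρ0.le hρ1.le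
  have hk : ∀ k : ℕ, φ (ρ ^ (k+1)) * (1 - ρ) ≤ ∫ t in (ρ^(k+1))..(ρ^k), φ t / t := by
    intro k
    have hle : ρ ^ (k+1) ≤ ρ ^ k := pow_le_pow_of_le_one hρ0.le hρ1.le (Nat.le_succ k)
    have h1 : ∫ t in (ρ^(k+1))..(ρ^k), φ (ρ^(k+1)) / ρ^k ≤ ∫ t in (ρ^(k+1))..(ρ^k), φ t / t := by
      refine intervalIntegral.integral_mono_on hle (by simp) (hsub _ _ (by positivity) hle (hpow k)) ?_
      intro t ht
      have ht0 : 0 < t := lt_of_lt_of_le (by positivity) ht.1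
      refine div_le_div₀ (hnn t ht0.le) ?_ ht0 ht.2
      exact hm (Set.mem_Ici.2 (by positivity)) ht0.le ht.1
    refine le_trans (le_of_eq ?_) h1
    rw [intervalIntegral.integral_const, smul_eq_mul]
    have : ρ ^ k ≠ 0 := by positivity
    field_simp
    ring
  have hs1 : Summable fun k : ℕ => φ (ρ ^ (k+1)) := by
    refine summable_of_sum_range_le (c := (∫ t in (0:ℝ)..1, φ t / t) / (1 - ρ)) (fun k => hnn _ (by positivity)) ?_
    intro n
    rw [le_div_iff₀ (by linarith), Finset.sum_mul]
    refine (Finset.sum_le_sum fun k _ => hk k).trans ?_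
    have h2 : ∑ k ∈ Finset.range n, ∫ t in (ρ^(k+1))..(ρ^k), φ t / t
        = ∫ t in (ρ^n)..1, φ t / t := by
      have := intervalIntegral.sum_integral_adjacent_intervals (μ := volume) (f := fun t => φ t / t)
        (a := fun k : ℕ => ρ ^ k) (n := n) (fun k _ => (hsub _ _ (by positivity)
          (pow_le_pow_of_le_one hρ0.le hρ1.le (Nat.le_succ k)) (hpow k)).symm)
      rw [intervalIntegral.integral_symm, pow_zero] at this
      rw [← neg_inj, ← this, ← Finset.sum_neg_distrib]
      refine Finset.sum_congr rfl fun k _ => ?_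
      rw [← intervalIntegral.integral_symm]
    rw [h2]
    have h3 := intervalIntegral.integral_add_adjacent_intervals
      (hsub 0 (ρ^n) le_rfl (by positivity) (hpow n)) (hsub (ρ^n) 1 (by positivity) (hpow n) le_rfl)
    have h4 : 0 ≤ ∫ t in (0:ℝ)..(ρ^n), φ t / t :=
      intervalIntegral.integral_nonneg (by positivity) fun t ht => div_nonneg (hnn t ht.1) ht.1
    linarith
  have hs : Summable fun k : ℕ => φ (ρ ^ k) := (summable_nat_add_iff 1).1 hs1
  obtain ⟨k0, hk0⟩ : ∃ k0 : ℕ, r * ρ ^ k0 ≤ 1 := by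
    have := (tendsto_pow_atTop_nhds_zero_of_lt_one hρ0.le hρ1).const_mul r
    rw [mul_zero] at this
    obtain ⟨k0, h⟩ := (this.eventually_le_const zero_lt_one).exists
    exact ⟨k0, h⟩
  refine (summable_nat_add_iff k0).1 (Summable.of_nonneg_of_le (fun k => hnn _ (by positivity)) (fun k => ?_) hs)
  refine hm (Set.mem_Ici.2 (by positivity)) (Set.mem_Ici.2 (by positivity)) ?_
  rw [pow_add]
  nlinarith [pow_pos hρ0 k]

lemma dini_continuous {X : Type*} [PseudoMetricSpace X] {p : X → ℝ} (h : DiniContinuous p) :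
    Continuous p := by
  obtain ⟨φ, hm, h0, hi, hφ⟩ := h
  have hs := (dini_summable hm h0 hi (ρ := 1/2) (by norm_num) (by norm_num)
    (zero_le_one)).tendsto_atTop_zero
  rw [Metric.continuous_iff]
  intro x ε hε
  obtain ⟨k, hk⟩ := (hs.eventually_lt_const hε).exists
  refine ⟨1 * (1/2)^k, by positivity, fun y hy => ?_⟩
  rw [Real.dist_eq]
  refine lt_of_le_of_lt ((hφ y x).trans (hm dist_nonneg ?_ hy.le)) hk
  exact Set.mem_Ici.2 (by positivity)

lemma UOp_bound {X : Type*} {L : ℕ} {p : Fin L → X → ℝ} {W : Fin L → X → X}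
    {K : Set X} (hK : ∀ ℓ, ∀ x ∈ K, W ℓ x ∈ K)
    (hp0 : ∀ ℓ x, 0 ≤ p ℓ x) (hp1 : ∀ x, ∑ ℓ, p ℓ x = 1) {f : X → ℝ} {a b : ℝ}
    (hf : ∀ x ∈ K, f x ∈ Set.Icc a b) (n : ℕ) : ∀ x ∈ K, (UOp p W)^[n] f x ∈ Set.Icc a b := by
  induction n with
  | zero => exact hf
  | succ n ih =>
    intro x hx
    rw [Function.iterate_succ_apply']
    constructor
    · calc a = ∑ ℓ, p ℓ x * a := by rw [← Finset.sum_mul, hp1, one_mul]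
        _ ≤ _ := Finset.sum_le_sum fun ℓ _ =>
          mul_le_mul_of_nonneg_left (ih _ (hK ℓ x hx)).1 (hp0 ℓ x)
    · calc _ ≤ ∑ ℓ, p ℓ x * b := Finset.sum_le_sum fun ℓ _ =>
          mul_le_mul_of_nonneg_left (ih _ (hK ℓ x hx)).2 (hp0 ℓ x)
        _ = b := by rw [← Finset.sum_mul, hp1, one_mul]

lemma UOp_continuous {X : Type*} [TopologicalSpace X] {L : ℕ} {p : Fin L → X → ℝ}
    {W : Fin L → X → X} (hp : ∀ ℓ, Continuous (p ℓ)) (hW : ∀ ℓ, Continuous (W ℓ))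
    {f : X → ℝ} (hf : Continuous f) (n : ℕ) : Continuous ((UOp p W)^[n] f) := by
  induction n with
  | zero => exact hf
  | succ n ih =>
    rw [Function.iterate_succ_apply']
    unfold UOp at ih ⊢
    exact continuous_finsetSum _ fun ℓ _ => (hp ℓ).mul (ih.comp (hW ℓ))

section meas
variable {X : Type*} [TopologicalSpace X] [MeasurableSpace X] [BorelSpace X]
  {L : ℕ} {p : Fin L → X → ℝ} {W : Fin L → X → X}

lemma ifs_measurable (hp : ∀ ℓ, Continuous (p ℓ)) (hW : ∀ ℓ, Continuous (W ℓ)) :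
    Measurable (IFSKernel p W) := by
  refine Measure.measurable_of_measurable_coe _ fun s hs => ?_
  simp only [IFSKernel, Measure.finsetSum_apply, Measure.smul_apply, smul_eq_mul]
  refine Finset.measurable_sum _ fun ℓ _ => ?_
  refine (ENNReal.measurable_ofReal.comp (hp ℓ).measurable).mul ?_
  exact (Measure.measurable_coe hs).comp (Measure.measurable_dirac.comp (hW ℓ).measurable)

lemma ifs_prob (hp0 : ∀ ℓ x, 0 ≤ p ℓ x) (hp1 : ∀ x, ∑ ℓ, p ℓ x = 1) (x : X) :
    IsProbabilityMeasure (IFSKernel p W x) := by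
  constructor
  simp only [IFSKernel, Measure.finsetSum_apply, Measure.smul_apply, smul_eq_mul, measure_univ,
    mul_one]
  rw [← ENNReal.ofReal_sum_of_nonneg (fun ℓ _ => hp0 ℓ x), hp1, ENNReal.ofReal_one]

lemma ifs_bind_prob (hp : ∀ ℓ, Continuous (p ℓ)) (hW : ∀ ℓ, Continuous (W ℓ))
    (hp0 : ∀ ℓ x, 0 ≤ p ℓ x) (hp1 : ∀ x, ∑ ℓ, p ℓ x = 1) (ν : Measure X)
    [IsProbabilityMeasure ν] : IsProbabilityMeasure (ν.bind (IFSKernel p W)) :=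
  isProbabilityMeasure_bind (ifs_measurable hp hW).aemeasurable
    (Eventually.of_forall fun x => ifs_prob hp0 hp1 x)

lemma ifs_integral (hp0 : ∀ ℓ x, 0 ≤ p ℓ x) {f : X → ℝ} (hf : Continuous f) (x : X) :
    ∫ y, f y ∂(IFSKernel p W x) = UOp p W f x := by
  have hfs : StronglyMeasurable f := hf.measurable.stronglyMeasurable
  unfold IFSKernel UOp
  rw [integral_finsetSum_measure]
  · refine Finset.sum_congr rfl fun ℓ _ => ?_
    rw [integral_smul_measure, integral_dirac' _ _ hfs, ENNReal.toReal_ofReal (hp0 ℓ x),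
      smul_eq_mul]
  · intro ℓ _
    refine Integrable.smul_measure ?_ ENNReal.ofReal_ne_top
    exact integrable_dirac' hfs (by simp)

lemma ifs_bind_integral (hp : ∀ ℓ, Continuous (p ℓ)) (hW : ∀ ℓ, Continuous (W ℓ))
    (hp0 : ∀ ℓ x, 0 ≤ p ℓ x) (hp1 : ∀ x, ∑ ℓ, p ℓ x = 1) {f : X → ℝ} (hf : Continuous f)
    {B : ℝ} (hB : ∀ x, |f x| ≤ B) (ν : Measure X) [IsProbabilityMeasure ν] :
    ∫ x, f x ∂(ν.bind (IFSKernel p W)) = ∫ x, UOp p W f x ∂ν := by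
  have := ifs_bind_prob hp hW hp0 hp1 ν
  let η : ProbabilityTheory.Kernel X X := ⟨IFSKernel p W, ifs_measurable hp hW⟩
  have hη : ν.bind (IFSKernel p W) = (ProbabilityTheory.Kernel.comp η (ProbabilityTheory.Kernel.const Unit ν)) () := by
    rw [ProbabilityTheory.Kernel.comp_apply, ProbabilityTheory.Kernel.const_apply]; rfl
  have hint : Integrable f (ν.bind (IFSKernel p W)) :=
    Integrable.of_bound hf.measurable.aestronglyMeasurable B (Eventually.of_forall hB)
  rw [hη] at hint ⊢
  rw [ProbabilityTheory.Kernel.integral_comp hint, ProbabilityTheory.Kernel.const_apply]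
  exact integral_congr_ae (Eventually.of_forall fun x => ifs_integral hp0 hf x)

lemma ifs_iter_prob (hp : ∀ ℓ, Continuous (p ℓ)) (hW : ∀ ℓ, Continuous (W ℓ))
    (hp0 : ∀ ℓ x, 0 ≤ p ℓ x) (hp1 : ∀ x, ∑ ℓ, p ℓ x = 1) (ν : Measure X)
    [IsProbabilityMeasure ν] (n : ℕ) :
    IsProbabilityMeasure ((fun m : Measure X => m.bind (IFSKernel p W))^[n] ν) := by
  induction n with
  | zero => assumption
  | succ n ih =>
    rw [Function.iterate_succ_apply']
    exact ifs_bind_prob hp hW hp0 hp1 _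

lemma ifs_iter_integral (hp : ∀ ℓ, Continuous (p ℓ)) (hW : ∀ ℓ, Continuous (W ℓ))
    (hp0 : ∀ ℓ x, 0 ≤ p ℓ x) (hp1 : ∀ x, ∑ ℓ, p ℓ x = 1) {f : X → ℝ} (hf : Continuous f)
    {B : ℝ} (hB : ∀ x, |f x| ≤ B) (n : ℕ) (ν : Measure X) [IsProbabilityMeasure ν] :
    ∫ x, f x ∂((fun m : Measure X => m.bind (IFSKernel p W))^[n] ν)
      = ∫ x, (UOp p W)^[n] f x ∂ν := by
  induction n generalizing ν with
  | zero => rfl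
  | succ n ih =>
    have := ifs_bind_prob hp hW hp0 hp1 ν
    rw [Function.iterate_succ_apply, ih, ifs_bind_integral hp hW hp0 hp1
      (UOp_continuous hp hW hf n) (B := B) _ ν, Function.iterate_succ_apply']
    intro x
    rw [abs_le]
    exact UOp_bound (K := Set.univ) (fun _ _ _ => trivial) hp0 hp1
      (fun x _ => abs_le.1 (hB x)) n x trivial

lemma ifs_iter_supp (hp : ∀ ℓ, Continuous (p ℓ)) (hW : ∀ ℓ, Continuous (W ℓ))
    {K : Set X} (hKm : MeasurableSet K) (hK : ∀ ℓ, ∀ x ∈ K, W ℓ x ∈ K) (ν : Measure X)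
    (hν : ν Kᶜ = 0) (n : ℕ) :
    ((fun m : Measure X => m.bind (IFSKernel p W))^[n] ν) Kᶜ = 0 := by
  induction n with
  | zero => exact hν
  | succ n ih =>
    rw [Function.iterate_succ_apply']
    rw [Measure.bind_apply hKm.compl (ifs_measurable hp hW).aemeasurable]
    refine (lintegral_congr_ae (g := fun _ => 0) ?_).trans (by simp)
    have h : ∀ᵐ x ∂((fun m : Measure X => m.bind (IFSKernel p W))^[n] ν), x ∈ K := ih
    filter_upwards [h] with x hx
    simp only [IFSKernel, Measure.finsetSum_apply, Measure.smul_apply, smul_eq_mul]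
    refine Finset.sum_eq_zero fun ℓ _ => ?_
    rw [Measure.dirac_apply' _ hKm.compl]
    simp [hK ℓ x hx]

end meas

theorem abstract_main {E : Type*} [NormedAddCommGroup E] [NormedSpace ℝ E]
    [FiniteDimensional ℝ E] [MeasurableSpace E] [BorelSpace E]
    (A : E →ₗ[ℝ] E) (C ρ : ℝ) (hC : 0 ≤ C) (hρ0 : 0 < ρ) (hρ1 : ρ < 1)
    (hA : ∀ (k : ℕ) (x : E), ‖(A ^ k) x‖ ≤ C * ρ ^ k * ‖x‖)
    {L : ℕ} (β : Fin L → E) (W : Fin L → E → E)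
    (hW : ∀ ℓ ξ, W ℓ ξ = A ξ + β ℓ) (p : Fin L → E → ℝ)
    (hp01 : ∀ ℓ x, p ℓ x ∈ Set.Icc (0 : ℝ) 1)
    (hpDini : ∀ ℓ, DiniContinuous (p ℓ))
    (hpsum : ∀ x, ∑ ℓ, p ℓ x = 1)
    (δ : ℝ) (hδ : 0 < δ) (hplb : ∀ ℓ x, δ ≤ p ℓ x) :
    ∃ μstar : Measure E,
      (IsProbabilityMeasure μstar ∧ Invariant (IFSKernel p W) μstar) ∧
      (∀ μ : Measure E,
        IsProbabilityMeasure μ → Invariant (IFSKernel p W) μ → μ = μstar) ∧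
      Attractive (IFSKernel p W) μstar := by
  have : ProperSpace E := FiniteDimensional.proper_real E
  have hp0 : ∀ ℓ x, 0 ≤ p ℓ x := fun ℓ x => (hp01 ℓ x).1
  have hpc : ∀ ℓ, Continuous (p ℓ) := fun ℓ => dini_continuous (hpDini ℓ)
  have hAc : ∀ k : ℕ, Continuous (A ^ k) := fun k => LinearMap.continuous_of_finiteDimensional _
  have hWc : ∀ ℓ, Continuous (W ℓ) := fun ℓ => by
    have : W ℓ = fun ξ => A ξ + β ℓ := funext (hW ℓ)
    rw [this]
    exact (LinearMap.continuous_of_finiteDimensional A).add continuous_const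
  have hL : Nonempty (Fin L) := by
    by_contra h
    rw [not_nonempty_iff] at h
    have := hpsum 0
    simp at this
  obtain ⟨ℓ0⟩ := hL
  set K : ℝ → Set E := fun M => {x | ∀ k : ℕ, ‖(A ^ k) x‖ ≤ M * ρ ^ k} with hKdef
  set Bβ := ∑ ℓ, ‖β ℓ‖
  set M0 := C * Bβ / (1 - ρ) with hM0
  have hβ : ∀ ℓ, ‖β ℓ‖ ≤ Bβ := fun ℓ =>
    Finset.single_le_sum (f := fun ℓ => ‖β ℓ‖) (fun _ _ => norm_nonneg _) (Finset.mem_univ ℓ)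
  have hBβ : 0 ≤ Bβ := (norm_nonneg _).trans (hβ ℓ0)
  have h1ρ : 0 < 1 - ρ := by linarith
  have hM00 : 0 ≤ M0 := by positivity
  have hAs : ∀ (k : ℕ) (x : E), (A ^ k) (A x) = (A ^ (k+1)) x := fun k x => by
    rw [pow_succ]; rfl
  have hK : ∀ M, M0 ≤ M → ∀ ℓ, ∀ x ∈ K M, W ℓ x ∈ K M := by
    intro M hM ℓ x hx k
    rw [hW, map_add, hAs]
    have h1 := hx (k+1)
    have h2 := hA k (β ℓ)
    have h3 : C * Bβ ≤ M * (1 - ρ) := by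
      rw [hM0, div_le_iff₀ h1ρ] at hM; exact hM
    have h4 : C * ρ ^ k * ‖β ℓ‖ ≤ C * ρ ^ k * Bβ :=
      mul_le_mul_of_nonneg_left (hβ ℓ) (by positivity)
    have h5 := mul_le_mul_of_nonneg_right h3 (pow_pos hρ0 k).le
    refine (norm_add_le _ _).trans ?_
    rw [pow_succ ρ] at h1
    nlinarith
  have hKclosed : ∀ M, IsClosed (K M) := by
    intro M
    have : K M = ⋂ k : ℕ, {x | ‖(A ^ k) x‖ ≤ M * ρ ^ k} := by ext; simp [hKdef]
    rw [this]
    exact isClosed_iInter fun k => isClosed_le (hAc k).norm continuous_const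
  have hKcomp : ∀ M, IsCompact (K M) := by
    intro M
    refine (isCompact_closedBall (0:E) M).of_isClosed_subset (hKclosed M) fun x hx => ?_
    simpa using hx 0
  have hKmem : ∀ x, ∃ M, M0 ≤ M ∧ x ∈ K M ∧ (0:E) ∈ K M := by
    intro x
    refine ⟨max M0 (C * ‖x‖), le_max_left _ _, fun k => ?_, fun k => ?_⟩
    · refine (hA k x).trans ?_
      have := mul_le_mul_of_nonneg_right (le_max_right M0 (C * ‖x‖)) (pow_pos hρ0 k).le
      linarith
    · rw [map_zero, norm_zero]
      exact mul_nonneg (hM00.trans (le_max_left _ _)) (by positivity)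
  choose φ hφm hφ0 hφi hφ using hpDini
  have hφnn : ∀ ℓ t, 0 ≤ t → 0 ≤ φ ℓ t := fun ℓ t ht => by
    rw [← hφ0 ℓ]; exact hφm ℓ (Set.mem_Ici.2 le_rfl) ht ht
  have hδ1 : δ ≤ 1 := (hplb ℓ0 0).trans (hp01 ℓ0 0).2
  -- oscillation
  have hosc : ∀ M, M0 ≤ M → ∀ f : BoundedContinuousFunction E ℝ, ∀ ε > 0, ∀ᶠ n in atTop,
      ∀ x ∈ K M, ∀ y ∈ K M, (UOp p W)^[n] f x - (UOp p W)^[n] f y ≤ ε := by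
    intro M hM f
    have hM0' : 0 ≤ M := hM00.trans hM
    have hRd : ∀ (j : ℕ) (x y : E), (∀ k : ℕ, ‖(A ^ k) (x - y)‖ ≤ 2 * M * ρ ^ (j + k)) →
        dist x y ≤ 2 * M * ρ ^ j := fun j x y h => by
      rw [dist_eq_norm]; simpa using h 0
    have hsum : Summable fun j : ℕ => ∑ ℓ, φ ℓ (2 * M * ρ ^ j) :=
      summable_sum fun ℓ _ => dini_summable (hφm ℓ) (hφ0 ℓ) (hφi ℓ) hρ0 hρ1 (by positivity)
    have hτ0 : ∀ j : ℕ, 0 ≤ min (1 - δ) (∑ ℓ, φ ℓ (2 * M * ρ ^ j)) := fun j =>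
      le_min (by linarith) (Finset.sum_nonneg fun ℓ _ => hφnn ℓ _ (by positivity))
    refine osc_tendsto p W (K M) (fun j x y => ∀ k : ℕ, ‖(A ^ k) (x - y)‖ ≤ 2 * M * ρ ^ (j + k))
      (hK M hM) ?_ ?_ ?_ hp0 hpsum (fun j => min (1 - δ) (∑ ℓ, φ ℓ (2 * M * ρ ^ j)))
      hτ0 ?_ ?_ ?_ f ‖f‖ (fun x => f.norm_coe_le_norm x) ?_
    · intro x hx y hy k
      rw [map_sub, zero_add]
      have := norm_sub_le ((A ^ k) x) ((A ^ k) y)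
      linarith [hx k, hy k]
    · intro j ℓ x y h k
      have : W ℓ x - W ℓ y = A (x - y) := by rw [hW, hW, map_sub]; abel
      rw [this, hAs]
      have := h (k+1)
      rwa [show j + 1 + k = j + (k + 1) by omega]
    · intro j x k
      rw [sub_self, map_zero, norm_zero]; positivity
    · intro j
      exact (min_le_left _ _).trans_lt (by linarith)
    · exact Summable.of_nonneg_of_le hτ0 (fun j => min_le_right _ _) hsum
    · intro j x _ y _ h
      have hd := hRd j x y h
      rcases min_choice (1 - δ) (∑ ℓ, φ ℓ (2 * M * ρ ^ j)) with h1 | h1 <;> rw [h1]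
      · have h2 : min (p ℓ0 x) (p ℓ0 y) ≤ ∑ ℓ, min (p ℓ x) (p ℓ y) :=
          Finset.single_le_sum (f := fun ℓ => min (p ℓ x) (p ℓ y))
            (fun ℓ _ => le_min (hp0 ℓ x) (hp0 ℓ y)) (Finset.mem_univ ℓ0)
        linarith [le_min (hplb ℓ0 x) (hplb ℓ0 y)]
      · rw [← hpsum x, ← Finset.sum_sub_distrib]
        refine Finset.sum_le_sum fun ℓ _ => ?_
        have h3 := (hφ ℓ x y).trans (hφm ℓ dist_nonneg (Set.mem_Ici.2 (by positivity)) hd)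
        have h4 := (abs_le.1 h3).2
        refine le_min ?_ (by linarith)
        linarith [hφnn ℓ (2 * M * ρ ^ j) (by positivity)]
    · intro ε hε
      have huc := (hKcomp M).uniformContinuousOn_of_continuous f.continuous.continuousOn
      rw [Metric.uniformContinuousOn_iff] at huc
      obtain ⟨η, hη, huc⟩ := huc ε hε
      have ht := (tendsto_pow_atTop_nhds_zero_of_lt_one hρ0.le hρ1).const_mul (2 * M)
      rw [mul_zero] at ht
      filter_upwards [ht.eventually_lt_const hη] with j hj x hx y hy h
      have := huc x hx y hy ((hRd j x y h).trans_lt hj)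
      rw [Real.dist_eq] at this
      exact (le_abs_self _).trans this.le
  -- pointwise convergence
  have hconv : ∀ f : BoundedContinuousFunction E ℝ, ∃ m, ∀ x,
      Tendsto (fun n => (UOp p W)^[n] f x) atTop (𝓝 m) := by
    intro f
    obtain ⟨M, hM, h0, -⟩ := hKmem 0
    have hcs : CauchySeq fun n => (UOp p W)^[n] f 0 := by
      rw [Metric.cauchySeq_iff']
      intro ε hε
      obtain ⟨N, hN⟩ := (hosc M hM f (ε/2) (by positivity)).exists
      refine ⟨N, fun n hn => ?_⟩
      obtain ⟨k, rfl⟩ := Nat.exists_eq_add_of_le' hn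
      rw [Function.iterate_add_apply]
      have hb := UOp_bound (hK M hM) hp0 hpsum (f := (UOp p W)^[N] f)
        (a := (UOp p W)^[N] f 0 - ε/2) (b := (UOp p W)^[N] f 0 + ε/2)
        (fun x hx => ⟨by linarith [hN 0 h0 x hx], by linarith [hN x hx 0 h0]⟩) k 0 h0
      rw [Real.dist_eq, abs_lt]
      constructor <;> linarith [hb.1, hb.2]
    obtain ⟨m, hm⟩ := cauchySeq_tendsto_of_complete hcs
    refine ⟨m, fun x => ?_⟩
    obtain ⟨M, hM, hx, h0⟩ := hKmem x
    have hd : Tendsto (fun n => (UOp p W)^[n] f x - (UOp p W)^[n] f 0) atTop (𝓝 0) := by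
      rw [Metric.tendsto_nhds]
      intro ε hε
      filter_upwards [hosc M hM f (ε/2) (by positivity)] with n hn
      rw [Real.dist_eq, sub_zero, abs_lt]
      constructor <;> linarith [hn x hx 0 h0, hn 0 h0 x hx]
    simpa using hd.add hm
  choose m hm using hconv
  have hint : ∀ (f : BoundedContinuousFunction E ℝ) (ν : Measure E), IsProbabilityMeasure ν →
      Tendsto (fun k => ∫ x, f x ∂((fun m : Measure E => m.bind (IFSKernel p W))^[k] ν))
        atTop (𝓝 (m f)) := by
    intro f ν hν
    simp_rw [fun k => ifs_iter_integral hpc hWc hp0 hpsum f.continuous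
      (fun x => f.norm_coe_le_norm x) k ν]
    have hc : m f = ∫ _, m f ∂ν := by simp
    rw [hc]
    refine tendsto_integral_of_dominated_convergence (fun _ => ‖f‖)
      (fun n => (UOp_continuous hpc hWc f.continuous n).measurable.aestronglyMeasurable)
      (integrable_const _) (fun n => Eventually.of_forall fun x => ?_)
      (Eventually.of_forall fun x => hm f x)
    rw [Real.norm_eq_abs, abs_le]
    exact UOp_bound (K := Set.univ) (fun _ _ _ => trivial) hp0 hpsum
      (fun x _ => abs_le.1 (f.norm_coe_le_norm x)) n x trivial
  -- existence of the limit measure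
  obtain ⟨μ, hμ⟩ : ∃ μ : ProbabilityMeasure E, ∀ f : BoundedContinuousFunction E ℝ,
      ∫ x, f x ∂(μ : Measure E) = m f := by
    obtain ⟨M, hM, h0, -⟩ := hKmem 0
    let μs : ℕ → ProbabilityMeasure E := fun n =>
      ⟨(fun m : Measure E => m.bind (IFSKernel p W))^[n] (Measure.dirac 0),
        ifs_iter_prob hpc hWc hp0 hpsum _ n⟩
    have hcomp : IsCompact (closure (Set.range μs)) := by
      refine isCompact_closure_of_isTightMeasureSet ?_
      rw [isTightMeasureSet_iff_exists_isCompact_measure_compl_le]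
      intro ε _
      refine ⟨K M, hKcomp M, ?_⟩
      rintro _ ⟨_, ⟨n, rfl⟩, rfl⟩
      have : ((fun m : Measure E => m.bind (IFSKernel p W))^[n] (Measure.dirac 0)) (K M)ᶜ = 0 :=
        ifs_iter_supp hpc hWc (hKclosed M).measurableSet (hK M hM) _
          (by rw [Measure.dirac_apply' _ (hKclosed M).measurableSet.compl]; simp [h0]) n
      exact le_of_eq_of_le this bot_le
    obtain ⟨μ, -, hμ⟩ := hcomp.exists_mapClusterPt (f := atTop) (u := μs)
      (tendsto_principal.2 (Eventually.of_forall fun n => subset_closure ⟨n, rfl⟩))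
    refine ⟨μ, fun f => ?_⟩
    have h1 := hμ.continuousAt_comp
      (ProbabilityMeasure.continuous_integral_boundedContinuousFunction f).continuousAt
    have h2 := hint f (Measure.dirac 0) inferInstance
    have h3 : ClusterPt (∫ x, f x ∂(μ : Measure E)) (𝓝 (m f)) := ClusterPt.mono h1 h2
    exact eq_of_nhds_neBot h3
  have hinv : (μ : Measure E).bind (IFSKernel p W) = μ := by
    have := ifs_bind_prob hpc hWc hp0 hpsum (μ : Measure E)
    refine ext_of_forall_integral_eq_of_IsFiniteMeasure fun f => ?_
    have hUb : ∀ x, ‖UOp p W f x‖ ≤ ‖f‖ := fun x => by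
      rw [Real.norm_eq_abs, abs_le]
      exact UOp_bound (K := Set.univ) (fun _ _ _ => trivial) hp0 hpsum
        (fun x _ => abs_le.1 (f.norm_coe_le_norm x)) 1 x trivial
    let g : BoundedContinuousFunction E ℝ := BoundedContinuousFunction.ofNormedAddCommGroup
      (UOp p W f) (UOp_continuous hpc hWc f.continuous 1) ‖f‖ hUb
    have hg : ∀ n, (UOp p W)^[n] g 0 = (UOp p W)^[n+1] f 0 := fun n => by
      rw [Function.iterate_succ_apply]; rfl
    have h1 := hm g 0
    simp_rw [hg] at h1
    have h2 : m g = m f := tendsto_nhds_unique h1 ((tendsto_add_atTop_iff_nat 1).2 (hm f 0))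
    rw [ifs_bind_integral hpc hWc hp0 hpsum f.continuous (fun x => f.norm_coe_le_norm x), hμ, ← h2,
      ← hμ]
    rfl
  refine ⟨μ, ⟨inferInstance, hinv⟩, fun μ' hμ' hinv' => ?_, fun ν hν f => ?_⟩
  · refine ext_of_forall_integral_eq_of_IsFiniteMeasure fun f => ?_
    have h1 := hint f μ' hμ'
    have h2 : ∀ k, (fun m : Measure E => m.bind (IFSKernel p W))^[k] μ' = μ' :=
      fun k => Function.iterate_fixed (f := fun m : Measure E => m.bind (IFSKernel p W)) hinv' k
    simp_rw [h2] at h1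
    rw [hμ, tendsto_nhds_unique tendsto_const_nhds h1]
  · rw [hμ]; exact hint f ν hν

lemma schur_eig {ι : Type*} [Fintype ι] [DecidableEq ι] {A : Matrix ι ι ℝ} (h : IsSchur A)
    {z : ℂ} (hz : 1 ≤ ‖z‖) {v : ι → ℂ} (hv : ∀ i, ∑ j, (A i j : ℂ) * v j = z * v i) : v = 0 := by
  by_contra hne
  refine absurd (h z ?_) (not_lt.2 hz)
  rw [spectrum.mem_iff, Matrix.isUnit_iff_isUnit_det, isUnit_iff_ne_zero, not_not,
    ← Matrix.exists_mulVec_eq_zero_iff]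
  refine ⟨v, hne, ?_⟩
  rw [Matrix.sub_mulVec, sub_eq_zero, Matrix.algebraMap_eq_diagonal]
  ext i
  rw [Matrix.mulVec_diagonal]
  simp only [Matrix.mulVec, dotProduct, Matrix.map_apply]
  rw [hv]
  rfl

lemma schur_of_eig {ι : Type*} [Fintype ι] [DecidableEq ι] {A : Matrix ι ι ℝ}
    (h : ∀ z : ℂ, 1 ≤ ‖z‖ → ∀ v : ι → ℂ, (∀ i, ∑ j, (A i j : ℂ) * v j = z * v i) → v = 0) :
    IsSchur A := by
  intro z hz
  by_contra hlt
  rw [spectrum.mem_iff, Matrix.isUnit_iff_isUnit_det, isUnit_iff_ne_zero, not_not,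
    ← Matrix.exists_mulVec_eq_zero_iff] at hz
  obtain ⟨v, hne, hv⟩ := hz
  refine hne (h z (not_lt.1 hlt) v fun i => ?_)
  rw [Matrix.sub_mulVec, sub_eq_zero, Matrix.algebraMap_eq_diagonal] at hv
  have := congrFun hv i
  rw [Matrix.mulVec_diagonal] at this
  exact this.symm

lemma schur_blockDiagonal {N : ℕ} {n : Fin N → ℕ} (A : ∀ i, Matrix (Fin (n i)) (Fin (n i)) ℝ)
    (h : ∀ i, IsSchur (A i)) : IsSchur (Matrix.blockDiagonal' A) := by
  refine schur_of_eig fun z hz v hv => ?_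
  have : ∀ k, (fun a => v ⟨k, a⟩) = 0 := by
    intro k
    refine schur_eig (h k) hz fun a => ?_
    rw [← hv ⟨k, a⟩, Fintype.sum_sigma, Finset.sum_eq_single k]
    · simp [Matrix.blockDiagonal'_apply_eq]
    · intro l _ hl
      refine Finset.sum_eq_zero fun b _ => ?_
      rw [Matrix.blockDiagonal'_apply_ne _ _ _ hl.symm]; simp
    · simp
  funext ⟨k, a⟩
  exact congrFun (this k) a

open scoped Matrix.Norms.L2Operator in
lemma schur_bound {ι : Type*} [Fintype ι] [DecidableEq ι] {A : Matrix ι ι ℝ} (h : IsSchur A) :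
    ∃ C ρ : ℝ, 0 ≤ C ∧ 0 < ρ ∧ ρ < 1 ∧ ∀ (k : ℕ) (x : EuclideanSpace ℝ ι),
      ‖((Matrix.toEuclideanLin A) ^ k) x‖ ≤ C * ρ ^ k * ‖x‖ := by
  set Ac : Matrix ι ι ℂ := A.map (fun x : ℝ => (x : ℂ)) with hAc
  have hsr : spectralRadius ℂ Ac < 1 := by
    rcases (spectrum ℂ Ac).eq_empty_or_nonempty with he | hne
    · rw [spectralRadius, he]; simp
    · have := spectrum.spectralRadius_lt_of_forall_lt_of_nonempty hne (r := 1)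
        (fun z hz => by exact_mod_cast h z hz)
      simpa using this
  obtain ⟨r, hr1, hr2⟩ := ENNReal.lt_iff_exists_nnreal_btwn.1 hsr
  have hr2' : (r : ℝ) < 1 := by exact_mod_cast hr2
  have hr0 : (0 : ℝ) < r := by
    have : (0 : ENNReal) < r := lt_of_le_of_lt bot_le hr1
    exact_mod_cast this
  have hG := (spectrum.pow_nnnorm_pow_one_div_tendsto_nhds_spectralRadius Ac).eventually_lt_const hr1
  have hO : (fun n : ℕ => Ac ^ n) =O[atTop] (fun n : ℕ => (r : ℝ) ^ n) := by
    refine Asymptotics.IsBigO.of_bound 1 ?_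
    filter_upwards [hG, eventually_gt_atTop 0] with n hn hn0
    have hn0' : (0:ℝ) < n := by exact_mod_cast hn0
    rw [one_div, ENNReal.rpow_inv_lt_iff hn0', ENNReal.rpow_natCast] at hn
    have h1 : ‖Ac ^ n‖₊ < r ^ n := by exact_mod_cast hn
    have h2 : ‖Ac ^ n‖ < (r : ℝ) ^ n := by exact_mod_cast h1
    rw [one_mul, Real.norm_of_nonneg (by positivity)]
    exact h2.le
  obtain ⟨C, hC, hb⟩ := Asymptotics.bound_of_isBigO_nat_atTop hO
  refine ⟨C, r, hC.le, hr0, hr2', fun k x => ?_⟩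
  have hbk := hb (x := k) (by positivity)
  rw [Real.norm_of_nonneg (by positivity)] at hbk
  let cx : EuclideanSpace ℝ ι → EuclideanSpace ℂ ι := fun x => WithLp.toLp 2 fun i => (x i : ℂ)
  have hcx : ∀ x, ‖cx x‖ = ‖x‖ := fun x => by
    simp [EuclideanSpace.norm_eq, cx]
  have hstep : ∀ x, cx (Matrix.toEuclideanLin A x) = Matrix.toEuclideanLin Ac (cx x) := by
    intro x
    ext i
    simp [cx, hAc, Matrix.toEuclideanLin, Matrix.mulVec, dotProduct]
  have hpow : ∀ k : ℕ, ∀ x, cx ((Matrix.toEuclideanLin A ^ k) x) = Matrix.toEuclideanLin (Ac ^ k) (cx x) := by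
    intro k
    induction k with
    | zero => intro x; ext i; simp [Matrix.toEuclideanLin]
    | succ k ih =>
      intro x
      rw [pow_succ', Module.End.mul_apply, hstep, ih, pow_succ']
      ext i
      simp [Matrix.toEuclideanLin]
  rw [← hcx, hpow, ← hcx x]
  exact (Matrix.l2_opNorm_mulVec (Ac ^ k) (cx x)).trans
    (mul_le_mul_of_nonneg_right hbk (norm_nonneg _))

/-- Proposition 2: one driver population with elastic demand and a single controller.
The augmented matrix `𝒜` is block lower triangular with diagonal blocks the block diagonal
matrices of the Schur agent matrices `A₁ i`, `A₂ i` and the Schur controller matrix `Ac`; the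
affine maps `W ℓ ξ = 𝒜 ξ + β ℓ` are chosen with Dini continuous probabilities bounded below
by `δ > 0`.  Then the associated Markov kernel has a unique invariant Borel probability
measure, which is attractive. -/
theorem elastic_demand_unique_attractive_invariant_measure
    {N₁ N₂ : ℕ} {n₁ : Fin N₁ → ℕ} {n₂ : Fin N₂ → ℕ} {d₃ : ℕ}
    (A₁ : ∀ i : Fin N₁, Matrix (Fin (n₁ i)) (Fin (n₁ i)) ℝ)
    (A₂ : ∀ i : Fin N₂, Matrix (Fin (n₂ i)) (Fin (n₂ i)) ℝ)
    (Ac : Matrix (Fin d₃) (Fin d₃) ℝ)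
    (hA₁ : ∀ i, IsSchur (A₁ i)) (hA₂ : ∀ i, IsSchur (A₂ i)) (hAc : IsSchur Ac)
    (𝒜 : Matrix (Idx3 N₁ N₂ n₁ n₂ d₃) (Idx3 N₁ N₂ n₁ n₂ d₃) ℝ)
    (hlower : ∀ i j, blk3 i < blk3 j → 𝒜 i j = 0)
    (hD₁ : ∀ a b, 𝒜 (Sum.inl a) (Sum.inl b) = Matrix.blockDiagonal' A₁ a b)
    (hD₂ : ∀ a b, 𝒜 (Sum.inr (Sum.inl a)) (Sum.inr (Sum.inl b)) = Matrix.blockDiagonal' A₂ a b)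
    (hD₃ : ∀ a b, 𝒜 (Sum.inr (Sum.inr a)) (Sum.inr (Sum.inr b)) = Ac a b)
    {L : ℕ} (β : Fin L → EuclideanSpace ℝ (Idx3 N₁ N₂ n₁ n₂ d₃))
    (W : Fin L → EuclideanSpace ℝ (Idx3 N₁ N₂ n₁ n₂ d₃) →
      EuclideanSpace ℝ (Idx3 N₁ N₂ n₁ n₂ d₃))
    (hW : ∀ ℓ ξ, W ℓ ξ = Matrix.toEuclideanLin 𝒜 ξ + β ℓ)
    (p : Fin L → EuclideanSpace ℝ (Idx3 N₁ N₂ n₁ n₂ d₃) → ℝ)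
    (hp01 : ∀ ℓ x, p ℓ x ∈ Set.Icc (0 : ℝ) 1)
    (hpDini : ∀ ℓ, DiniContinuous (p ℓ))
    (hpsum : ∀ x, ∑ ℓ, p ℓ x = 1)
    (δ : ℝ) (hδ : 0 < δ) (hplb : ∀ ℓ x, δ ≤ p ℓ x) :
    ∃ μstar : Measure (EuclideanSpace ℝ (Idx3 N₁ N₂ n₁ n₂ d₃)),
      (IsProbabilityMeasure μstar ∧ Invariant (IFSKernel p W) μstar) ∧
      (∀ μ : Measure (EuclideanSpace ℝ (Idx3 N₁ N₂ n₁ n₂ d₃)),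
        IsProbabilityMeasure μ → Invariant (IFSKernel p W) μ → μ = μstar) ∧
      Attractive (IFSKernel p W) μstar := by
  have hS : IsSchur 𝒜 := by
    have e12 : ∀ a b, 𝒜 (Sum.inl a) (Sum.inr (Sum.inl b)) = 0 := fun a b =>
      hlower _ _ (by simp [blk3])
    have e13 : ∀ a b, 𝒜 (Sum.inl a) (Sum.inr (Sum.inr b)) = 0 := fun a b =>
      hlower _ _ (by simp [blk3])
    have e23 : ∀ a b, 𝒜 (Sum.inr (Sum.inl a)) (Sum.inr (Sum.inr b)) = 0 := fun a b =>
      hlower _ _ (by simp [blk3])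
    refine schur_of_eig fun z hz v hv => ?_
    have h1 : (fun a => v (Sum.inl a)) = 0 := by
      refine schur_eig (schur_blockDiagonal A₁ hA₁) hz fun a => ?_
      rw [← hv (Sum.inl a), Fintype.sum_sum_type, Fintype.sum_sum_type]
      simp [e12, e13, hD₁]
    have h1' : ∀ a, v (Sum.inl a) = 0 := fun a => congrFun h1 a
    have h2 : (fun a => v (Sum.inr (Sum.inl a))) = 0 := by
      refine schur_eig (schur_blockDiagonal A₂ hA₂) hz fun a => ?_
      rw [← hv (Sum.inr (Sum.inl a)), Fintype.sum_sum_type, Fintype.sum_sum_type]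
      simp [e23, hD₂, h1']
    have h2' : ∀ a, v (Sum.inr (Sum.inl a)) = 0 := fun a => congrFun h2 a
    have h3 : (fun a => v (Sum.inr (Sum.inr a))) = 0 := by
      refine schur_eig hAc hz fun a => ?_
      rw [← hv (Sum.inr (Sum.inr a)), Fintype.sum_sum_type, Fintype.sum_sum_type]
      simp [hD₃, h1', h2']
    funext i
    rcases i with a | a | a
    · exact h1' a
    · exact h2' a
    · exact congrFun h3 a
  obtain ⟨C, ρ, hC, hρ0, hρ1, hA⟩ := schur_bound hS
  exact abstract_main (Matrix.toEuclideanLin 𝒜) C ρ hC hρ0 hρ1 hA β W hW p hp01 hpDini hpsum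
    δ hδ hplb
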